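/- Let n = 1 and p' = p/(p−1). Then: (i) if 2 ≤ p < 4, there exists C > 0 with ‖φ_ν‖_{L^p(ℝ)}‖φ_ν‖_{L^{p'}(ℝ)} ≤ C for all ν ∈ ℕ₀; (ii) if 4 < p ≤ ∞, there exists C > 0 with ‖φ_ν‖_{L^p(ℝ)}‖φ_ν‖_{L^{p'}(ℝ)} ≤ C ν^{−1/6 + (2/3)(1/2 − 1/p)} for all ν ≥ 1. -/

import Mathlib

open MeasureTheory Filter
open scoped ENNReal

noncomputable section

/-- Physicists' Hermite polynomial `H_k` as a real function:
`H_k(t) = (−1)^k e^{t²} (d/dt)^k e^{−t²}`. -/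
def hermitePolyFun (k : ℕ) (t : ℝ) : ℝ :=
  (-1 : ℝ) ^ k * Real.exp (t ^ 2) * iteratedDeriv k (fun s => Real.exp (-s ^ 2)) t

/-- One-dimensional Hermite function `φ_k(t) = (2^k k! √π)^{-1/2} H_k(t) e^{-t²/2}`. -/
def hermiteFun (k : ℕ) (t : ℝ) : ℝ :=
  ((2 : ℝ) ^ k * (Nat.factorial k : ℝ) * Real.sqrt Real.pi) ^ (-(1 : ℝ) / 2) *
    hermitePolyFun k t * Real.exp (-(t ^ 2) / 2)

/-- Hermite function `φ_ν` on `ℝⁿ`, `φ_ν(x) = ∏ⱼ φ_{νⱼ}(xⱼ)`. -/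
def hermiteFunPi {n : ℕ} (ν : Fin n → ℕ) (x : Fin n → ℝ) : ℝ :=
  ∏ j, hermiteFun (ν j) (x j)

/-- Fourier–Hermite coefficient `f̂(φ_ν) = ∫ f(x) φ_ν(x) dx` of a Schwartz function. -/
def hermiteCoeff {n : ℕ} (f : SchwartzMap (Fin n → ℝ) ℂ) (ν : Fin n → ℕ) : ℂ :=
  ∫ x : Fin n → ℝ, f x * (hermiteFunPi ν x : ℂ)

/-- Pseudo-multiplier associated to the harmonic oscillator:
`T_m f(x) = Σ_ν m(x,ν) f̂(φ_ν) φ_ν(x)`. -/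
def pseudoMult {n : ℕ} (m : (Fin n → ℝ) → (Fin n → ℕ) → ℂ)
    (f : SchwartzMap (Fin n → ℝ) ℂ) (x : Fin n → ℝ) : ℂ :=
  ∑' ν : Fin n → ℕ, m x ν * hermiteCoeff f ν * (hermiteFunPi ν x : ℂ)

/-- Inverse Fourier–Hermite transform `𝓕_H⁻¹ u (x) = Σ_ν u(ν) φ_ν(x)`. -/
def fhInv {n : ℕ} (u : (Fin n → ℕ) → ℂ) (x : Fin n → ℝ) : ℂ :=
  ∑' ν : Fin n → ℕ, u ν * (hermiteFunPi ν x : ℂ)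

/-- Euclidean Fourier transform on `ℝⁿ` (modelled as `Fin n → ℝ`). -/
def fourierPi {n : ℕ} (g : (Fin n → ℝ) → ℂ) (x : Fin n → ℝ) : ℂ :=
  ∫ ξ : Fin n → ℝ, Complex.exp (-(2 * Real.pi * (∑ j, x j * ξ j)) * Complex.I) * g ξ

/-- One-dimensional Fourier transform. -/
def fourier1 (g : ℝ → ℂ) (t : ℝ) : ℂ :=
  ∫ τ : ℝ, Complex.exp (-(2 * Real.pi * (t * τ)) * Complex.I) * g τ

/-- Partial derivative in the `j`-th coordinate. -/
def pderiv1 {n : ℕ} (j : Fin n) (f : (Fin n → ℝ) → ℂ) : (Fin n → ℝ) → ℂ :=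
  fun ξ => fderiv ℝ f ξ (Pi.single j 1)

/-- Multi-index partial derivative `∂^α`. -/
def pderivMulti {n : ℕ} (α : Fin n → ℕ) (f : (Fin n → ℝ) → ℂ) : (Fin n → ℝ) → ℂ :=
  (List.finRange n).foldr (fun j g => (pderiv1 j)^[α j] g) f

/-- Forward difference in the `j`-th coordinate. -/
def dDiff {n : ℕ} (j : Fin n) (g : (Fin n → ℕ) → ℂ) : (Fin n → ℕ) → ℂ :=
  fun ν => g (ν + Pi.single j 1) - g ν

/-- Multi-index forward difference `Δ^α`. -/
def dDiffMulti {n : ℕ} (α : Fin n → ℕ) (g : (Fin n → ℕ) → ℂ) : (Fin n → ℕ) → ℂ :=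
  (List.finRange n).foldr (fun j h => (dDiff j)^[α j] h) g

/-- Projection onto the `ℓ`-th Hermite eigenspace: `P_ℓ f = Σ_{|ν|=ℓ} f̂(φ_ν) φ_ν`. -/
def hermiteProj {n : ℕ} (f : SchwartzMap (Fin n → ℝ) ℂ) (ℓ : ℕ) (x : Fin n → ℝ) : ℂ :=
  ∑' ν : Fin n → ℕ, if (∑ j, ν j) = ℓ then hermiteCoeff f ν * (hermiteFunPi ν x : ℂ) else 0

/-- Spectral pseudo-multiplier `m(x,H) f(x) = Σ_ℓ m(x,ℓ) P_ℓ f(x)`. -/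
def spectralPM {n : ℕ} (m : (Fin n → ℝ) → ℝ → ℂ)
    (f : SchwartzMap (Fin n → ℝ) ℂ) (x : Fin n → ℝ) : ℂ :=
  ∑' ℓ : ℕ, m x (ℓ : ℝ) * hermiteProj f ℓ x

/-- Multilinear pseudo-multiplier. -/
def multiPM {n κ : ℕ} (m : (Fin n → ℝ) → (Fin κ → Fin n → ℕ) → ℂ)
    (f : Fin κ → SchwartzMap (Fin n → ℝ) ℂ) (x : Fin n → ℝ) : ℂ :=
  ∑' ν : Fin κ → Fin n → ℕ,
    m x ν * (∏ j, hermiteCoeff (f j) (ν j)) * ∏ j, (hermiteFunPi (ν j) x : ℂ)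

/-- Inverse Fourier–Hermite transform on `ℝ^{nκ}` (modelled as `Fin κ → Fin n → ℝ`). -/
def fhInv2 {n κ : ℕ} (u : (Fin κ → Fin n → ℕ) → ℂ) (z : Fin κ → Fin n → ℝ) : ℂ :=
  ∑' ν : Fin κ → Fin n → ℕ, u ν * ∏ j, (hermiteFunPi (ν j) (z j) : ℂ)

/-- Euclidean Fourier transform on `ℝ^{nκ}` (modelled as `Fin κ → Fin n → ℝ`). -/
def fourierPi2 {n κ : ℕ} (g : (Fin κ → Fin n → ℝ) → ℂ) (z : Fin κ → Fin n → ℝ) : ℂ :=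
  ∫ ξ : Fin κ → Fin n → ℝ,
    Complex.exp (-(2 * Real.pi * (∑ j, ∑ i, z j i * ξ j i)) * Complex.I) * g ξ

open Polynomial in
/-- The physicists' Hermite polynomials, as elements of `ℝ[X]`. -/
def physHermite : ℕ → Polynomial ℝ
  | 0 => 1
  | k + 1 => 2 * X * physHermite k - derivative (physHermite k)

open Polynomial in
lemma derivative_physHermite_succ (k : ℕ) :
    derivative (physHermite (k + 1)) = 2 * ((k : ℝ[X]) + 1) * physHermite k := by
  induction k with
  | zero => simp [physHermite]
  | succ k ih =>
    rw [physHermite, map_sub, derivative_mul, ih]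
    have h2 : derivative (2 * X : ℝ[X]) = 2 := by
      simp [derivative_mul]
    have h3 : derivative (2 * ((k : ℝ[X]) + 1) * physHermite k)
        = 2 * ((k : ℝ[X]) + 1) * derivative (physHermite k) := by
      simp [derivative_mul]
    rw [h2, h3]
    conv_lhs => enter [1, 1]; rw [physHermite]
    conv_rhs => rw [physHermite]
    push_cast
    ring

lemma hasDerivAt_exp_neg_sq (x : ℝ) :
    HasDerivAt (fun s : ℝ => Real.exp (-s ^ 2)) (-2 * x * Real.exp (-x ^ 2)) x := by
  have := ((hasDerivAt_pow 2 x).fun_neg).exp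
  convert this using 1
  simp
  ring

lemma hasDerivAt_eval_mul_exp_neg_sq (P : Polynomial ℝ) (x : ℝ) :
    HasDerivAt (fun s => P.eval s * Real.exp (-s ^ 2))
      ((P.derivative - 2 * Polynomial.X * P).eval x * Real.exp (-x ^ 2)) x := by
  refine ((P.hasDerivAt x).fun_mul (hasDerivAt_exp_neg_sq x)).congr_deriv ?_
  simp
  ring

lemma integrable_eval_mul_exp_neg_sq (P : Polynomial ℝ) :
    Integrable (fun s => P.eval s * Real.exp (-s ^ 2)) := by
  induction P using Polynomial.induction_on' with
  | add p q hp hq => 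
    simp only [Polynomial.eval_add, add_mul]
    exact hp.add hq
  | monomial n a =>
    have h := integrable_rpow_mul_exp_neg_mul_sq (b := 1) one_pos (s := n)
      (lt_of_lt_of_le (by norm_num) n.cast_nonneg)
    simpa [mul_assoc] using h.const_mul a

lemma iteratedDeriv_exp_neg_sq (k : ℕ) :
    iteratedDeriv k (fun s : ℝ => Real.exp (-s ^ 2)) =
      fun x => (-1) ^ k * ((physHermite k).eval x * Real.exp (-x ^ 2)) := by
  induction k with
  | zero => simp [physHermite]
  | succ k ih =>
    rw [iteratedDeriv_succ, ih]
    funext x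
    rw [((hasDerivAt_eval_mul_exp_neg_sq (physHermite k) x).const_mul _).deriv]
    simp [physHermite]
    ring

lemma hermitePolyFun_eq (k : ℕ) (x : ℝ) : hermitePolyFun k x = (physHermite k).eval x := by
  have h : Real.exp (x ^ 2) * Real.exp (-x ^ 2) = 1 := by
    rw [← Real.exp_add]; simp
  have h1 : ((-1 : ℝ) ^ k) * (-1) ^ k = 1 := by
    rw [← mul_pow]; simp
  rw [hermitePolyFun, iteratedDeriv_exp_neg_sq]
  calc _ = ((-1 : ℝ) ^ k * (-1) ^ k) * (Real.exp (x ^ 2) * Real.exp (-x ^ 2)) *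
        (physHermite k).eval x := by ring
    _ = _ := by rw [h, h1]; ring

lemma physHermite_eval_neg (k : ℕ) (x : ℝ) :
    (physHermite k).eval (-x) = (-1) ^ k * (physHermite k).eval x := by
  have h : ∀ k, (physHermite k).comp (-Polynomial.X) = (-1) ^ k * physHermite k := by
    intro k
    induction k with
    | zero => simp [physHermite]
    | succ k ih =>
      have hd := congrArg Polynomial.derivative ih
      rw [Polynomial.derivative_comp, Polynomial.derivative_mul] at hd
      have h1 : Polynomial.derivative ((-1 : Polynomial ℝ) ^ k) = 0 := by
        have : ((-1 : Polynomial ℝ) ^ k) = Polynomial.C ((-1) ^ k) := by simp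
        rw [this, Polynomial.derivative_C]
      rw [h1] at hd
      simp only [Polynomial.derivative_neg, Polynomial.derivative_X] at hd
      simp only [physHermite, Polynomial.sub_comp, Polynomial.mul_comp, ih, Polynomial.X_comp,
        Polynomial.ofNat_comp]
      linear_combination hd
  have := congrArg (Polynomial.eval x) (h k)
  simpa using this

lemma integral_physHermite_sq (k : ℕ) :
    ∫ x, (physHermite k ^ 2).eval x * Real.exp (-x ^ 2) =
      2 ^ k * (Nat.factorial k : ℝ) * Real.sqrt Real.pi := by
  induction k with
  | zero =>
    have := integral_gaussian 1
    simpa [physHermite] using this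
  | succ k ih =>
    have h0 := integral_eq_zero_of_hasDerivAt_of_integrable
      (hasDerivAt_eval_mul_exp_neg_sq (physHermite (k + 1) * physHermite k))
      (integrable_eval_mul_exp_neg_sq _) (integrable_eval_mul_exp_neg_sq _)
    have h1 : ∀ x, (Polynomial.derivative (physHermite (k + 1) * physHermite k)
        - 2 * Polynomial.X * (physHermite (k + 1) * physHermite k)).eval x * Real.exp (-x ^ 2)
        = 2 * ((k : ℝ) + 1) * ((physHermite k ^ 2).eval x * Real.exp (-x ^ 2))
          - (physHermite (k + 1) ^ 2).eval x * Real.exp (-x ^ 2) := by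
      intro x
      have h2 : Polynomial.derivative (physHermite (k + 1) * physHermite k)
        - 2 * Polynomial.X * (physHermite (k + 1) * physHermite k)
        = 2 * ((k : Polynomial ℝ) + 1) * physHermite k ^ 2 - physHermite (k + 1) ^ 2 := by
        rw [Polynomial.derivative_mul, derivative_physHermite_succ]
        have : Polynomial.derivative (physHermite k)
          = 2 * Polynomial.X * physHermite k - physHermite (k + 1) := by
          rw [physHermite]; ring
        rw [this]
        ring
      rw [h2]
      simp
      ring
    simp_rw [h1] at h0
    rw [integral_sub ((integrable_eval_mul_exp_neg_sq _).const_mul _)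
      (integrable_eval_mul_exp_neg_sq _), integral_const_mul, ih] at h0
    rw [Nat.factorial_succ]
    push_cast
    linear_combination -h0

/-- A real solution `f` of the Hermite equation `f'' = (x² - m⁶) f` with derivative `g`, such that
`f`, `x f` and `g` are square integrable and `f` has norm one in `L²`. -/
structure IsHermiteSolution (m : ℝ) (f g : ℝ → ℝ) : Prop where
  one_le : 1 ≤ m
  deriv_f : ∀ x, HasDerivAt f (g x) x
  deriv_g : ∀ x, HasDerivAt g ((x ^ 2 - m ^ 6) * f x) x
  int_f : Integrable (fun x => f x ^ 2)
  int_xf : Integrable (fun x => x ^ 2 * f x ^ 2)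
  int_g : Integrable (fun x => g x ^ 2)
  norm_eq : ∫ x, f x ^ 2 = 1

lemma hasDerivAt_exp_neg_sq_half (x : ℝ) :
    HasDerivAt (fun s : ℝ => Real.exp (-(s ^ 2) / 2)) (-x * Real.exp (-(x ^ 2) / 2)) x := by
  have := (((hasDerivAt_pow 2 x).fun_neg).div_const 2).exp
  convert this using 1
  simp
  ring

lemma exp_neg_sq_half_sq (x : ℝ) : Real.exp (-(x ^ 2) / 2) ^ 2 = Real.exp (-x ^ 2) := by
  rw [← Real.exp_nat_mul]; congr 1; push_cast; ring

lemma isHermiteSolution_hermiteFun (k : ℕ) {m : ℝ} (hm : 1 ≤ m) (hmk : m ^ 6 = 2 * k + 1) :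
    ∃ g, IsHermiteSolution m (hermiteFun k) g := by
  set N : ℝ := (2 : ℝ) ^ k * (Nat.factorial k : ℝ) * Real.sqrt Real.pi with hN
  have hNpos : 0 < N := by positivity
  set c : ℝ := N ^ (-(1 : ℝ) / 2) with hc
  have hc2 : c ^ 2 * N = 1 := by
    rw [hc, ← Real.rpow_natCast, ← Real.rpow_mul hNpos.le]
    norm_num
    rw [Real.rpow_neg_one]
    exact inv_mul_cancel₀ hNpos.ne'
  set P := physHermite k with hP
  have hfun : ∀ x, hermiteFun k x = c * P.eval x * Real.exp (-(x ^ 2) / 2) := by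
    intro x; rw [hermiteFun, hermitePolyFun_eq]
  have hD : ∀ (R : Polynomial ℝ) (x : ℝ),
      HasDerivAt (fun s => c * R.eval s * Real.exp (-(s ^ 2) / 2))
        (c * (R.derivative - Polynomial.X * R).eval x * Real.exp (-(x ^ 2) / 2)) x := by
    intro R x
    refine (((R.hasDerivAt x).const_mul c).fun_mul (hasDerivAt_exp_neg_sq_half x)).congr_deriv ?_
    simp
    ring
  have hode : Polynomial.derivative (Polynomial.derivative P)
      = 2 * Polynomial.X * Polynomial.derivative P - 2 * (k : Polynomial ℝ) * P := by
    rw [hP]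
    cases k with
    | zero => simp [physHermite]
    | succ j =>
      rw [derivative_physHermite_succ]
      have h3 : Polynomial.derivative (2 * ((j : Polynomial ℝ) + 1) * physHermite j)
        = 2 * ((j : Polynomial ℝ) + 1) * Polynomial.derivative (physHermite j) := by
        simp [Polynomial.derivative_mul]
      rw [h3]
      conv_rhs => enter [2, 2]; rw [physHermite]
      push_cast
      ring
  have hI : ∀ R : Polynomial ℝ,
      Integrable (fun x => (c * R.eval x * Real.exp (-(x ^ 2) / 2)) ^ 2) := by
    intro R
    refine ((integrable_eval_mul_exp_neg_sq (R ^ 2)).const_mul (c ^ 2)).congr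
      (Eventually.of_forall fun x => ?_)
    simp only [mul_pow, exp_neg_sq_half_sq, Polynomial.eval_pow]
    ring
  refine ⟨fun x => c * (P.derivative - Polynomial.X * P).eval x * Real.exp (-(x ^ 2) / 2),
    hm, ?_, ?_, ?_, ?_, hI _, ?_⟩
  · intro x
    rw [funext hfun]
    exact hD P x
  · intro x
    convert hD _ x using 1
    rw [hfun, hmk]
    have : Polynomial.derivative (Polynomial.derivative P - Polynomial.X * P)
      - Polynomial.X * (Polynomial.derivative P - Polynomial.X * P)
      = (Polynomial.X ^ 2 - (2 * (k : Polynomial ℝ) + 1)) * P := by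
      rw [map_sub, hode, Polynomial.derivative_mul, Polynomial.derivative_X]
      ring
    rw [this]
    simp
    ring
  · simp_rw [hfun]; exact hI P
  · simp_rw [hfun]
    refine (hI (Polynomial.X * P)).congr (Eventually.of_forall fun x => ?_)
    simp
    ring
  · have : ∀ x, hermiteFun k x ^ 2 = c ^ 2 * ((P ^ 2).eval x * Real.exp (-x ^ 2)) := by
      intro x
      rw [hfun, mul_pow, mul_pow, exp_neg_sq_half_sq, Polynomial.eval_pow, mul_assoc]
    simp_rw [this]
    rw [integral_const_mul, integral_physHermite_sq, hc2]

lemma abs_hermiteFun_neg (k : ℕ) (x : ℝ) : |hermiteFun k (-x)| = |hermiteFun k x| := by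
  simp [hermiteFun, hermitePolyFun_eq, physHermite_eval_neg, abs_mul]

namespace IsHermiteSolution

variable {m : ℝ} {f g : ℝ → ℝ}

lemma continuous_f (h : IsHermiteSolution m f g) : Continuous f :=
  continuous_iff_continuousAt.2 fun x => (h.deriv_f x).continuousAt

lemma continuous_g (h : IsHermiteSolution m f g) : Continuous g :=
  continuous_iff_continuousAt.2 fun x => (h.deriv_g x).continuousAt

lemma integrable_mul (h : IsHermiteSolution m f g) : Integrable (fun x => f x * g x) := by
  refine (h.int_f.add h.int_g).mono' (h.continuous_f.mul h.continuous_g).aestronglyMeasurable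
    (Eventually.of_forall fun x => ?_)
  simp only [Pi.add_apply, Real.norm_eq_abs, abs_le]
  constructor <;> nlinarith [sq_nonneg (f x + g x), sq_nonneg (f x - g x)]

lemma integrable_id_mul_sq (h : IsHermiteSolution m f g) :
    Integrable (fun x => x * f x ^ 2) := by
  refine (h.int_f.add h.int_xf).mono'
    (continuous_id.mul (h.continuous_f.pow 2)).aestronglyMeasurable
    (Eventually.of_forall fun x => ?_)
  have := sq_nonneg (f x)
  simp only [Pi.add_apply, Real.norm_eq_abs, abs_le]
  constructor
  · nlinarith [mul_nonneg (by nlinarith [sq_nonneg (x + 1)] : 0 ≤ 1 + x + x ^ 2) this]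
  · nlinarith [mul_nonneg (by nlinarith [sq_nonneg (x - 1)] : 0 ≤ 1 - x + x ^ 2) this]

lemma integrable_deriv_mul (h : IsHermiteSolution m f g) :
    Integrable (fun x => g x ^ 2 + (x ^ 2 * f x ^ 2 - m ^ 6 * f x ^ 2)) :=
  h.int_g.add (h.int_xf.sub (h.int_f.const_mul _))

lemma hasDerivAt_mul (h : IsHermiteSolution m f g) (x : ℝ) :
    HasDerivAt (fun x => f x * g x) (g x ^ 2 + (x ^ 2 * f x ^ 2 - m ^ 6 * f x ^ 2)) x := by
  refine ((h.deriv_f x).fun_mul (h.deriv_g x)).congr_deriv ?_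
  ring

lemma integral_sq_mul_sq_le (h : IsHermiteSolution m f g) :
    ∫ x, x ^ 2 * f x ^ 2 ≤ m ^ 6 := by
  have h0 := integral_eq_zero_of_hasDerivAt_of_integrable h.hasDerivAt_mul
    h.integrable_deriv_mul h.integrable_mul
  have hi : Integrable (fun x => x ^ 2 * f x ^ 2 - m ^ 6 * f x ^ 2) :=
    h.int_xf.sub (h.int_f.const_mul _)
  rw [integral_add h.int_g hi, integral_sub h.int_xf (h.int_f.const_mul _), integral_const_mul, h.norm_eq] at h0
  have : 0 ≤ ∫ x, g x ^ 2 := integral_nonneg fun x => sq_nonneg _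
  linarith

lemma hasDerivAt_energy (h : IsHermiteSolution m f g) (x : ℝ) :
    HasDerivAt (fun x => (m ^ 6 - x ^ 2) * f x ^ 2 + g x ^ 2) (-2 * (x * f x ^ 2)) x := by
  have h1 : HasDerivAt (fun x : ℝ => m ^ 6 - x ^ 2) (-(2 * x)) x := by
    simpa using (hasDerivAt_pow 2 x).const_sub (m ^ 6)
  refine ((h1.fun_mul ((h.deriv_f x).fun_pow 2)).fun_add ((h.deriv_g x).fun_pow 2)).congr_deriv ?_
  simp
  ring

lemma energy_eq (h : IsHermiteSolution m f g) (x : ℝ) :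
    (m ^ 6 - x ^ 2) * f x ^ 2 + g x ^ 2 = ∫ t in Set.Ioi x, 2 * (t * f t ^ 2) := by
  have hi : Integrable (fun x => (m ^ 6 - x ^ 2) * f x ^ 2 + g x ^ 2) := by
    refine (((h.int_f.const_mul (m ^ 6)).sub h.int_xf).add h.int_g).congr
      (Eventually.of_forall fun x => ?_)
    simp
    ring
  have hd := h.integrable_id_mul_sq.const_mul (-2)
  have ht := tendsto_zero_of_hasDerivAt_of_integrableOn_Ioi (a := x)
    (fun t _ => h.hasDerivAt_energy t) hd.integrableOn hi.integrableOn
  have := integral_Ioi_of_hasDerivAt_of_tendsto (a := x)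
    (h.hasDerivAt_energy x).continuousAt.continuousWithinAt
    (fun t _ => h.hasDerivAt_energy t) hd.integrableOn ht
  rw [integral_const_mul] at this ⊢
  linarith

lemma energy_zero_le (h : IsHermiteSolution m f g) :
    m ^ 6 * f 0 ^ 2 + g 0 ^ 2 ≤ 2 * m ^ 3 := by
  have hm : 0 < m := one_pos.trans_le h.one_le
  have h0 := h.energy_eq 0
  have hI : Integrable (fun t => m ^ 3 * f t ^ 2 + (m ^ 3)⁻¹ * (t ^ 2 * f t ^ 2)) :=
    (h.int_f.const_mul _).add (h.int_xf.const_mul _)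
  have h1 : ∫ t in Set.Ioi 0, 2 * (t * f t ^ 2) ≤
      ∫ t in Set.Ioi 0, (m ^ 3 * f t ^ 2 + (m ^ 3)⁻¹ * (t ^ 2 * f t ^ 2)) := by
    refine setIntegral_mono (h.integrable_id_mul_sq.const_mul 2).integrableOn hI.integrableOn
      fun t => ?_
    have : m ^ 3 * f t ^ 2 + (m ^ 3)⁻¹ * (t ^ 2 * f t ^ 2) - 2 * (t * f t ^ 2)
      = (m ^ 3)⁻¹ * ((t - m ^ 3) * f t) ^ 2 := by
      field_simp
      ring
    have h2 : 0 ≤ (m ^ 3)⁻¹ * ((t - m ^ 3) * f t) ^ 2 := by positivity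
    simp only
    linarith
  have h2 := setIntegral_le_integral (s := Set.Ioi 0) hI
    (Eventually.of_forall fun t => by positivity)
  rw [integral_add (h.int_f.const_mul _) (h.int_xf.const_mul _), integral_const_mul,
    integral_const_mul, h.norm_eq] at h2
  have h3 : (m ^ 3)⁻¹ * ∫ x, x ^ 2 * f x ^ 2 ≤ (m ^ 3)⁻¹ * m ^ 6 :=
    mul_le_mul_of_nonneg_left h.integral_sq_mul_sq_le (by positivity)
  have h4 : (m ^ 3)⁻¹ * m ^ 6 = m ^ 3 := by field_simp
  have h5 : (m ^ 6 - (0 : ℝ) ^ 2) = m ^ 6 := by ring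
  rw [h5] at h0
  linarith

lemma energy_le (h : IsHermiteSolution m f g) {x : ℝ} (hx : 0 ≤ x) (hxm : x ^ 2 + m ^ 2 ≤ m ^ 6) :
    (m ^ 6 - x ^ 2) * f x ^ 2 + g x ^ 2 ≤ 12 * √(m ^ 6 - x ^ 2) := by
  have hm : 0 < m := one_pos.trans_le h.one_le
  set s : ℝ → ℝ := fun y => √(m ^ 6 - y ^ 2) with hs
  set F : ℝ → ℝ := fun y => (m ^ 6 - y ^ 2) * f y ^ 2 + g y ^ 2 with hF
  set G : ℝ → ℝ := fun y => F y / s y - y / s y ^ 3 * (f y * g y) with hG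
  have hy2 : ∀ y ∈ Set.Icc 0 x, m ^ 2 ≤ m ^ 6 - y ^ 2 := by
    intro y hy
    nlinarith [hy.1, hy.2]
  have hsm : ∀ y ∈ Set.Icc 0 x, m ≤ s y := fun y hy => Real.le_sqrt_of_sq_le (hy2 y hy)
  have hs2 : ∀ y ∈ Set.Icc 0 x, s y ^ 2 = m ^ 6 - y ^ 2 := fun y hy =>
    Real.sq_sqrt ((sq_nonneg m).trans (hy2 y hy))
  have hh : ∀ y ∈ Set.Icc 0 x, y / s y ^ 3 ≤ 1 := by
    intro y hy
    have h1 : y ≤ m ^ 3 := by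
      refine le_of_sq_le_sq ?_ (by positivity)
      nlinarith [hy2 y hy, sq_nonneg m]
    have h2 : m ^ 3 ≤ s y ^ 3 := pow_le_pow_left₀ hm.le (hsm y hy) 3
    exact (div_le_one ((pow_pos hm 3).trans_le h2)).2 (h1.trans h2)
  have hfg : ∀ y ∈ Set.Icc 0 x, |f y * g y| ≤ F y / s y / 2 := by
    intro y hy
    have hsp : 0 < s y := hm.trans_le (hsm y hy)
    have : F y = (s y * f y) ^ 2 + g y ^ 2 := by
      simp only [hF]; rw [← hs2 y hy]; ring
    rw [this, div_div, le_div_iff₀ (by positivity), ← abs_of_pos (by positivity : 0 < s y * 2),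
      ← abs_mul, abs_le]
    constructor <;> nlinarith [sq_nonneg (s y * f y - g y), sq_nonneg (s y * f y + g y)]
  have hder : ∀ y ∈ Set.Icc 0 x, HasDerivAt (fun y => Real.exp (-(y / s y ^ 3)) * G y)
      (-(Real.exp (-(y / s y ^ 3)) * (1 / s y ^ 3 + 3 * y ^ 2 / s y ^ 5) * (G y + f y * g y)))
      y := by
    intro y hy
    have hsp : 0 < s y := hm.trans_le (hsm y hy)
    have d0 : HasDerivAt (fun x : ℝ => m ^ 6 - x ^ 2) (-(2 * y)) y := by
      simpa using (hasDerivAt_pow 2 y).const_sub (m ^ 6)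
    have d1 : HasDerivAt s (-(y / s y)) y := by
      refine (d0.sqrt ?_).congr_deriv ?_
      · rw [← hs2 y hy]; positivity
      · change -(2 * y) / (2 * s y) = _
        field_simp
    have d2 : HasDerivAt (fun y => y / s y ^ 3) (1 / s y ^ 3 + 3 * y ^ 2 / s y ^ 5) y := by
      refine ((hasDerivAt_id y).fun_div (d1.fun_pow 3) (by positivity)).congr_deriv ?_
      simp only [id]
      field_simp
      norm_num
      ring
    have d3 : HasDerivAt G (-((1 / s y ^ 3 + 3 * y ^ 2 / s y ^ 5) * (f y * g y))) y := by
      refine (((h.hasDerivAt_energy y).fun_div d1 hsp.ne').fun_sub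
        (d2.fun_mul (h.hasDerivAt_mul y))).congr_deriv ?_
      have e : m ^ 6 = s y ^ 2 + y ^ 2 := by rw [hs2 y hy]; ring
      rw [e]
      field_simp
      ring
    refine (d2.fun_neg.exp.fun_mul d3).congr_deriv ?_
    ring
  have hanti : AntitoneOn (fun y => Real.exp (-(y / s y ^ 3)) * G y) (Set.Icc 0 x) := by
    refine antitoneOn_of_deriv_nonpos (convex_Icc 0 x)
      (fun y hy => (hder y hy).continuousAt.continuousWithinAt)
      (fun y hy => (hder y (interior_subset hy)).differentiableAt.differentiableWithinAt)
      fun y hy => ?_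
    have hy := interior_subset hy
    rw [(hder y hy).deriv]
    have hsp : 0 < s y := hm.trans_le (hsm y hy)
    have h1 := hfg y hy
    have h2 := hh y hy
    have h3 : 0 ≤ y / s y ^ 3 := div_nonneg hy.1 (by positivity)
    have h4 : |(1 - y / s y ^ 3) * (f y * g y)| ≤ F y / s y / 2 := by
      rw [abs_mul, abs_of_nonneg (by linarith)]
      nlinarith [abs_nonneg (f y * g y)]
    have h5 : 0 ≤ G y + f y * g y := by
      have := (abs_le.1 h4).1
      have h6 := (abs_nonneg _).trans h1
      simp only [hG]
      linarith
    have h7 : 0 ≤ 1 / s y ^ 3 + 3 * y ^ 2 / s y ^ 5 := by positivity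
    have := mul_nonneg (mul_nonneg (Real.exp_pos (-(y / s y ^ 3))).le h7) h5
    linarith
  have hx' : x ∈ Set.Icc 0 x := ⟨hx, le_rfl⟩
  have hK := hanti (⟨le_rfl, hx⟩ : (0 : ℝ) ∈ Set.Icc 0 x) hx' hx
  have hs0 : s 0 = m ^ 3 := by
    simp only [hs]
    rw [show m ^ 6 - (0 : ℝ) ^ 2 = (m ^ 3) ^ 2 by ring]
    exact Real.sqrt_sq (by positivity)
  have hG0 : G 0 ≤ 2 := by
    simp only [hG, hs0, hF]
    have := h.energy_zero_le
    rw [zero_div, zero_mul, sub_zero, div_le_iff₀ (by positivity)]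
    nlinarith
  have hGx : F x / s x / 2 ≤ G x := by
    have h1 := hfg x hx'
    have h3 : 0 ≤ x / s x ^ 3 := div_nonneg hx (pow_nonneg (hm.le.trans (hsm x hx')) 3)
    have h4 : |x / s x ^ 3 * (f x * g x)| ≤ F x / s x / 2 := by
      rw [abs_mul, abs_of_nonneg h3]
      nlinarith [abs_nonneg (f x * g x), hh x hx']
    have := (abs_le.1 h4).2
    simp only [hG]
    linarith
  have hsp : 0 < s x := hm.trans_le (hsm x hx')
  have hF0 : 0 ≤ F x / s x / 2 := (abs_nonneg _).trans (hfg x hx')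
  have he : Real.exp (-1) ≤ Real.exp (-(x / s x ^ 3)) :=
    Real.exp_le_exp.2 (by linarith [hh x hx'])
  have h8 : Real.exp (-1) * (F x / s x / 2) ≤ 2 := by
    have h9 : Real.exp (-1) * (F x / s x / 2) ≤ Real.exp (-(x / s x ^ 3)) * G x :=
      mul_le_mul he hGx hF0 (Real.exp_pos _).le
    simp only [zero_div, neg_zero, Real.exp_zero, one_mul] at hK
    linarith
  have h10 : F x / s x ≤ 12 := by
    have h11 : Real.exp 1 * Real.exp (-1) = 1 := by rw [← Real.exp_add]; simp
    have h12 : F x / s x / 2 = Real.exp 1 * (Real.exp (-1) * (F x / s x / 2)) := by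
      rw [← mul_assoc, h11, one_mul]
    have h13 : Real.exp 1 * (Real.exp (-1) * (F x / s x / 2)) ≤ Real.exp 1 * 2 :=
      mul_le_mul_of_nonneg_left h8 (Real.exp_pos _).le
    have := Real.exp_one_lt_d9
    linarith
  exact (div_le_iff₀ hsp).1 h10

lemma sq_le_of_inner (h : IsHermiteSolution m f g) {x : ℝ} (hx : 0 ≤ x)
    (hxm : x ^ 2 + m ^ 2 ≤ m ^ 6) : f x ^ 2 ≤ 12 / √(m ^ 6 - x ^ 2) := by
  have hm : 0 < m := one_pos.trans_le h.one_le
  have h1 : 0 < m ^ 6 - x ^ 2 := by nlinarith [pow_pos hm 2]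
  have hs : 0 < √(m ^ 6 - x ^ 2) := Real.sqrt_pos.2 h1
  have h2 := h.energy_le hx hxm
  have h3 : √(m ^ 6 - x ^ 2) ^ 2 = m ^ 6 - x ^ 2 := Real.sq_sqrt h1.le
  rw [le_div_iff₀ hs]
  set s := √(m ^ 6 - x ^ 2)
  rw [← h3] at h2
  have : s * (f x ^ 2 * s) ≤ s * 12 := by nlinarith [sq_nonneg (g x)]
  exact le_of_mul_le_mul_left this hs

section Outer

variable {x₀ : ℝ}

lemma setIntegral_sq_le (h : IsHermiteSolution m f g) (hx₀ : 0 ≤ x₀)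
    (hx₀m : x₀ ^ 2 + m ^ 2 = m ^ 6) : ∫ t in Set.Ioi x₀, f t ^ 2 ≤ 12 / m ^ 2 := by
  have hm : 0 < m := one_pos.trans_le h.one_le
  have hA1 : ∫ t in Set.Ioi x₀, f t ^ 2 ≤ 1 := by
    rw [← h.norm_eq]
    exact setIntegral_le_integral h.int_f (Eventually.of_forall fun t => sq_nonneg _)
  have hA0 : 0 ≤ ∫ t in Set.Ioi x₀, f t ^ 2 := integral_nonneg fun t => sq_nonneg _
  rw [le_div_iff₀ (by positivity)]
  rcases le_total (m ^ 2) 12 with h12 | h12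
  · nlinarith
  have hF := h.energy_le hx₀ hx₀m.le
  have hs : √(m ^ 6 - x₀ ^ 2) = m := by
    rw [← hx₀m, add_sub_cancel_left]; exact Real.sqrt_sq hm.le
  rw [hs, h.energy_eq] at hF
  have h1 : ∫ t in Set.Ioi x₀, (2 * x₀) * f t ^ 2 ≤ ∫ t in Set.Ioi x₀, 2 * (t * f t ^ 2) := by
    refine setIntegral_mono_on (h.int_f.const_mul _).integrableOn
      (h.integrable_id_mul_sq.const_mul 2).integrableOn measurableSet_Ioi fun t ht => ?_
    have : x₀ ≤ t := le_of_lt ht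
    nlinarith [mul_le_mul_of_nonneg_right this (sq_nonneg (f t))]
  rw [integral_const_mul] at h1
  have h2 : m ^ 3 ≤ 2 * x₀ := by
    refine le_of_sq_le_sq ?_ (by positivity)
    have : m ^ 6 = m ^ 2 * m ^ 4 := by ring
    nlinarith [mul_le_mul_of_nonneg_left h12 (sq_nonneg m), sq_nonneg m]
  have h3 : m * (m ^ 2 * ∫ t in Set.Ioi x₀, f t ^ 2) ≤ m * 12 := by
    nlinarith [mul_le_mul_of_nonneg_right h2 hA0]
  linarith [le_of_mul_le_mul_left h3 hm]

lemma setIntegral_deriv_sq_le (h : IsHermiteSolution m f g) (hx₀ : 0 ≤ x₀)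
    (hx₀m : x₀ ^ 2 + m ^ 2 = m ^ 6) : ∫ t in Set.Ioi x₀, g t ^ 2 ≤ 18 := by
  have hm : 0 < m := one_pos.trans_le h.one_le
  have hA := h.setIntegral_sq_le hx₀ hx₀m
  rw [le_div_iff₀ (by positivity)] at hA
  have ht := tendsto_zero_of_hasDerivAt_of_integrableOn_Ioi (a := x₀)
    (fun t _ => h.hasDerivAt_mul t) h.integrable_deriv_mul.integrableOn
    h.integrable_mul.integrableOn
  have hI := integral_Ioi_of_hasDerivAt_of_tendsto (a := x₀)
    (h.hasDerivAt_mul x₀).continuousAt.continuousWithinAt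
    (fun t _ => h.hasDerivAt_mul t) h.integrable_deriv_mul.integrableOn ht
  have hle : ∫ t in Set.Ioi x₀, (g t ^ 2 - m ^ 2 * f t ^ 2) ≤
      ∫ t in Set.Ioi x₀, (g t ^ 2 + (t ^ 2 * f t ^ 2 - m ^ 6 * f t ^ 2)) := by
    refine setIntegral_mono_on (h.int_g.sub (h.int_f.const_mul _)).integrableOn
      h.integrable_deriv_mul.integrableOn measurableSet_Ioi fun t ht => ?_
    have h1 : x₀ ≤ t := le_of_lt ht
    have h2 : 0 ≤ t ^ 2 - m ^ 6 + m ^ 2 := by nlinarith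
    nlinarith [mul_nonneg h2 (sq_nonneg (f t))]
  rw [integral_sub h.int_g.integrableOn (h.int_f.const_mul _).integrableOn,
    integral_const_mul] at hle
  have hF := h.energy_le hx₀ hx₀m.le
  have hs : √(m ^ 6 - x₀ ^ 2) = m := by
    rw [← hx₀m, add_sub_cancel_left]; exact Real.sqrt_sq hm.le
  rw [hs, ← hx₀m, add_sub_cancel_left] at hF
  have hfg : m * -(f x₀ * g x₀) ≤ m * 6 := by nlinarith [sq_nonneg (m * f x₀ + g x₀)]
  have := le_of_mul_le_mul_left hfg hm
  linarith

lemma sq_le_of_outer (h : IsHermiteSolution m f g) (hx₀ : 0 ≤ x₀)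
    (hx₀m : x₀ ^ 2 + m ^ 2 = m ^ 6) {x : ℝ} (hx : x₀ ≤ x) : f x ^ 2 ≤ 30 / m := by
  have hm : 0 < m := one_pos.trans_le h.one_le
  have hd : ∀ t, HasDerivAt (fun t => f t ^ 2) (2 * (f t * g t)) t := by
    intro t
    refine ((h.deriv_f t).fun_pow 2).congr_deriv ?_
    simp
    ring
  have hi := h.integrable_mul.const_mul 2
  have ht := tendsto_zero_of_hasDerivAt_of_integrableOn_Ioi (a := x) (fun t _ => hd t)
    hi.integrableOn h.int_f.integrableOn
  have hI := integral_Ioi_of_hasDerivAt_of_tendsto (a := x)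
    (hd x).continuousAt.continuousWithinAt (fun t _ => hd t) hi.integrableOn ht
  have hJ : Integrable (fun t => m * f t ^ 2 + m⁻¹ * g t ^ 2) :=
    (h.int_f.const_mul _).add (h.int_g.const_mul _)
  have h1 : ∫ t in Set.Ioi x, -(2 * (f t * g t)) ≤
      ∫ t in Set.Ioi x, (m * f t ^ 2 + m⁻¹ * g t ^ 2) := by
    refine setIntegral_mono hi.neg.integrableOn hJ.integrableOn fun t => ?_
    have : m * f t ^ 2 + m⁻¹ * g t ^ 2 + (2 * (f t * g t)) = m⁻¹ * (m * f t + g t) ^ 2 := by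
      field_simp
      ring
    have h2 : 0 ≤ m⁻¹ * (m * f t + g t) ^ 2 := by positivity
    simp only
    linarith
  have h2 : ∫ t in Set.Ioi x, (m * f t ^ 2 + m⁻¹ * g t ^ 2) ≤
      ∫ t in Set.Ioi x₀, (m * f t ^ 2 + m⁻¹ * g t ^ 2) :=
    setIntegral_mono_set hJ.integrableOn (Eventually.of_forall fun t => by positivity)
      (Set.Ioi_subset_Ioi hx).eventuallyLE
  have h6 : ∫ t in Set.Ioi x₀, (m * f t ^ 2 + m⁻¹ * g t ^ 2) =
      m * (∫ t in Set.Ioi x₀, f t ^ 2) + m⁻¹ * ∫ t in Set.Ioi x₀, g t ^ 2 := by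
    rw [integral_add (h.int_f.const_mul _).integrableOn (h.int_g.const_mul _).integrableOn,
      integral_const_mul, integral_const_mul]
  rw [integral_neg] at h1
  have h3 := mul_le_mul_of_nonneg_left (h.setIntegral_sq_le hx₀ hx₀m) hm.le
  have h4 := mul_le_mul_of_nonneg_left (h.setIntegral_deriv_sq_le hx₀ hx₀m)
    (inv_pos.2 hm).le
  have h5 : m * (12 / m ^ 2) + m⁻¹ * 18 = 30 / m := by
    field_simp
    norm_num
  linarith

end Outer

lemma sq_le (h : IsHermiteSolution m f g) {x : ℝ} (hx : 0 ≤ x) : f x ^ 2 ≤ 30 / m := by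
  have hm : 0 < m := one_pos.trans_le h.one_le
  have hm6 : m ^ 2 ≤ m ^ 6 := pow_le_pow_right₀ h.one_le (by norm_num)
  have hx₀m : √(m ^ 6 - m ^ 2) ^ 2 + m ^ 2 = m ^ 6 := by
    rw [Real.sq_sqrt (by linarith)]; ring
  rcases le_total √(m ^ 6 - m ^ 2) x with h1 | h1
  · exact h.sq_le_of_outer (Real.sqrt_nonneg _) hx₀m h1
  · have h2 : x ^ 2 + m ^ 2 ≤ m ^ 6 := by
      have := pow_le_pow_left₀ hx h1 2
      linarith
    refine (h.sq_le_of_inner hx h2).trans ?_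
    have : m ≤ √(m ^ 6 - x ^ 2) := Real.le_sqrt_of_sq_le (by linarith)
    gcongr
    norm_num

end IsHermiteSolution

lemma eLpNorm_le_of_lintegral_le {f : ℝ → ℝ} {p : ℝ≥0∞} (hp : p ≠ 0) (hp' : p ≠ ∞) {A : ℝ}
    (hA : 0 ≤ A) (h : ∫⁻ x, ENNReal.ofReal (|f x| ^ p.toReal) ≤ ENNReal.ofReal A) :
    eLpNorm f p volume ≤ ENNReal.ofReal (A ^ (1 / p.toReal)) := by
  have hp0 : 0 < p.toReal := ENNReal.toReal_pos hp hp'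
  rw [eLpNorm_eq_lintegral_rpow_enorm_toReal hp hp',
    ← ENNReal.ofReal_rpow_of_nonneg hA (by positivity)]
  refine ENNReal.rpow_le_rpow (le_trans (le_of_eq ?_) h) (by positivity)
  refine lintegral_congr fun x => ?_
  rw [Real.enorm_eq_ofReal_abs, ENNReal.ofReal_rpow_of_nonneg (abs_nonneg _) hp0.le]

lemma lintegral_eq_two_mul_of_even {F : ℝ → ℝ≥0∞} (heven : ∀ x, F (-x) = F x) :
    ∫⁻ x, F x = 2 * ∫⁻ x in Set.Ioi 0, F x := by
  have h1 : ∫⁻ x in Set.Iio 0, F x = ∫⁻ x in Set.Ioi 0, F x := by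
    have := (Measure.measurePreserving_neg (volume : Measure ℝ)).setLIntegral_comp_preimage_emb
      (MeasurableEquiv.neg ℝ).measurableEmbedding F (Set.Iio 0)
    rw [← this]
    simp [heven]
  rw [← lintegral_add_compl F (measurableSet_Ioi (a := (0 : ℝ))), Set.compl_Ioi,
    ← setLIntegral_congr Iio_ae_eq_Iic, h1, two_mul]

lemma rpow_abs_le_of_sq_le {a B r : ℝ} (hr : 0 ≤ r) (h : a ^ 2 ≤ B) : |a| ^ r ≤ B ^ (r / 2) := by
  have : |a| ^ r = (a ^ 2) ^ (r / 2) := by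
    rw [← sq_abs, ← Real.rpow_natCast, ← Real.rpow_mul (abs_nonneg a)]
    congr 1
    push_cast
    ring
  rw [this]
  exact Real.rpow_le_rpow (sq_nonneg a) h (by positivity)

namespace IsHermiteSolution

variable {m : ℝ} {f g : ℝ → ℝ}

lemma eLpNorm_le_of_le_two (h : IsHermiteSolution m f g) {q : ℝ≥0∞} (h1 : 1 ≤ q) (h2 : q ≤ 2) :
    eLpNorm f q volume ≤
      ENNReal.ofReal ((Real.pi + 2) ^ (1 / q.toReal) * m ^ (3 / q.toReal - 3 / 2)) := by
  have hm : 0 < m := one_pos.trans_le h.one_le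
  have hqt : q ≠ ∞ := ne_top_of_le_ne_top (by simp) h2
  have hq0 : q ≠ 0 := (one_pos.trans_le h1).ne'
  set r := q.toReal with hr
  have hr1 : 1 ≤ r := by simpa using ENNReal.toReal_mono hqt h1
  have hr2 : r ≤ 2 := by simpa using ENNReal.toReal_mono (by simp) h2
  set w : ℝ → ℝ := fun x => 1 + (x / m ^ 3) ^ 2 with hw
  have hw1 : ∀ x, 1 ≤ w x := fun x => by simp only [hw]; nlinarith [sq_nonneg (x / m ^ 3)]
  set R : ℝ → ℝ := fun x =>
    m ^ (-(3 / 2) * r) * (w x)⁻¹ + m ^ (3 - 3 / 2 * r) * (w x * f x ^ 2) with hR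
  have hpt : ∀ x, |f x| ^ r ≤ R x := by
    intro x
    have hwx : 0 < w x := one_pos.trans_le (hw1 x)
    have hP1 : 0 ≤ m ^ (-(3 / 2) * r) * (w x)⁻¹ := by positivity
    have hP2 : 0 ≤ m ^ (3 - 3 / 2 * r) * (w x * f x ^ 2) := by positivity
    set t : ℝ := m ^ (-(3 / 2) : ℝ) * (w x)⁻¹ with ht
    have ht0 : 0 < t := by positivity
    have htp : ∀ y : ℝ, t ^ y = m ^ (-(3 / 2) * y) * w x ^ (-y) := by
      intro y
      rw [ht, Real.mul_rpow (by positivity) (by positivity), ← Real.rpow_mul hm.le,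
        Real.inv_rpow hwx.le, Real.rpow_neg hwx.le]
    rcases le_total |f x| t with hc | hc
    · have h3 : |f x| ^ r ≤ t ^ r := Real.rpow_le_rpow (abs_nonneg _) hc (by linarith)
      have h4 : w x ^ (-r) ≤ (w x)⁻¹ := by
        rw [← Real.rpow_neg_one]
        exact Real.rpow_le_rpow_of_exponent_le (hw1 x) (by linarith)
      rw [htp] at h3
      have := mul_le_mul_of_nonneg_left h4 (Real.rpow_nonneg hm.le (-(3 / 2) * r))
      simp only [hR]
      linarith
    · have h3 : |f x| ^ r = |f x| ^ (r - 2) * f x ^ 2 := by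
        rw [← sq_abs (f x), ← Real.rpow_natCast, ← Real.rpow_add (ht0.trans_le hc)]
        congr 1
        push_cast
        ring
      have h4 : |f x| ^ (r - 2) ≤ t ^ (r - 2) :=
        Real.rpow_le_rpow_of_nonpos ht0 hc (by linarith)
      have h5 : w x ^ (-(r - 2)) ≤ w x := by
        conv_rhs => rw [← Real.rpow_one (w x)]
        exact Real.rpow_le_rpow_of_exponent_le (hw1 x) (by linarith)
      have h6 : -(3 / 2) * (r - 2) = 3 - 3 / 2 * r := by ring
      rw [htp, h6] at h4
      have h7 := h4.trans
        (mul_le_mul_of_nonneg_left h5 (Real.rpow_nonneg hm.le (3 - 3 / 2 * r)))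
      have h8 := mul_le_mul_of_nonneg_right h7 (sq_nonneg (f x))
      simp only [hR]
      rw [h3]
      linarith
  have hi1 : Integrable (fun x => (w x)⁻¹) :=
    integrable_inv_one_add_sq.comp_div (by positivity : m ^ 3 ≠ 0)
  have he2 : ∀ x, w x * f x ^ 2 = f x ^ 2 + (m ^ 6)⁻¹ * (x ^ 2 * f x ^ 2) := by
    intro x
    simp only [hw]
    field_simp
  have hi2 : Integrable (fun x => w x * f x ^ 2) := by
    simp_rw [he2]
    exact h.int_f.add (h.int_xf.const_mul _)
  have hI1 : ∫ x, (w x)⁻¹ = m ^ 3 * Real.pi := by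
    have := Measure.integral_comp_div (fun x : ℝ => (1 + x ^ 2)⁻¹) (m ^ 3)
    simp only [hw]
    rw [this, integral_univ_inv_one_add_sq, abs_of_pos (by positivity), smul_eq_mul]
  have hI2 : ∫ x, w x * f x ^ 2 ≤ 2 := by
    simp_rw [he2]
    rw [integral_add h.int_f (h.int_xf.const_mul _), integral_const_mul, h.norm_eq]
    have := mul_le_mul_of_nonneg_left h.integral_sq_mul_sq_le
      (by positivity : 0 ≤ (m ^ 6)⁻¹)
    rw [inv_mul_cancel₀ (by positivity)] at this
    linarith
  have hiR : Integrable R := (hi1.const_mul _).add (hi2.const_mul _)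
  have hIR : ∫ x, R x ≤ (Real.pi + 2) * m ^ (3 - 3 / 2 * r) := by
    simp only [hR]
    rw [integral_add (hi1.const_mul _) (hi2.const_mul _), integral_const_mul, integral_const_mul,
      hI1]
    have h3 : m ^ (-(3 / 2) * r) * (m ^ 3 * Real.pi) = Real.pi * m ^ (3 - 3 / 2 * r) := by
      have : m ^ (3 - 3 / 2 * r) = m ^ (-(3 / 2) * r) * m ^ 3 := by
        rw [← Real.rpow_natCast, ← Real.rpow_add hm]
        congr 1
        push_cast
        ring
      rw [this]
      ring
    have h4 := mul_le_mul_of_nonneg_left hI2 (Real.rpow_nonneg hm.le (3 - 3 / 2 * r))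
    linarith
  have hpi := Real.pi_pos
  have hfin : ∫⁻ x, ENNReal.ofReal (|f x| ^ r) ≤
      ENNReal.ofReal ((Real.pi + 2) * m ^ (3 - 3 / 2 * r)) := by
    refine (lintegral_mono fun x => ENNReal.ofReal_le_ofReal (hpt x)).trans ?_
    rw [← ofReal_integral_eq_lintegral_ofReal hiR (Eventually.of_forall fun x => ?_)]
    · exact ENNReal.ofReal_le_ofReal hIR
    · exact (Real.rpow_nonneg (abs_nonneg _) r).trans (hpt x)
  refine (eLpNorm_le_of_lintegral_le hq0 hqt (by positivity) hfin).trans (le_of_eq ?_)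
  rw [← hr, Real.mul_rpow (by positivity) (by positivity), ← Real.rpow_mul hm.le]
  congr 3
  have : r ≠ 0 := by linarith
  field_simp

lemma lintegral_Ioi_rpow_le (h : IsHermiteSolution m f g) {x₀ r : ℝ} (hr : 2 ≤ r)
    (hx₀ : 0 ≤ x₀) (hx₀m : x₀ ^ 2 + m ^ 2 = m ^ 6) :
    ∫⁻ x in Set.Ioi x₀, ENNReal.ofReal (|f x| ^ r) ≤
      ENNReal.ofReal (12 * 30 ^ (r / 2 - 1) * m ^ (-r / 2 - 1)) := by
  have hm : 0 < m := one_pos.trans_le h.one_le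
  set K : ℝ := (30 / m) ^ (r / 2 - 1) with hK
  have hpt : ∀ x ∈ Set.Ioi x₀, |f x| ^ r ≤ K * f x ^ 2 := by
    intro x hx
    have h1 := rpow_abs_le_of_sq_le (r := r - 2) (by linarith)
      (h.sq_le_of_outer hx₀ hx₀m (le_of_lt hx))
    have h2 : |f x| ^ r = |f x| ^ (r - 2) * f x ^ 2 := by
      rw [← sq_abs (f x), ← Real.rpow_natCast,
        ← Real.rpow_add_of_nonneg (abs_nonneg _) (by linarith) (by norm_num)]
      congr 1
      push_cast
      ring
    rw [h2, hK, show r / 2 - 1 = (r - 2) / 2 by ring]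
    exact mul_le_mul_of_nonneg_right h1 (sq_nonneg _)
  have hK0 : 0 ≤ K := by positivity
  refine (setLIntegral_mono' measurableSet_Ioi
    fun x hx => ENNReal.ofReal_le_ofReal (hpt x hx)).trans ?_
  rw [← ofReal_integral_eq_lintegral_ofReal (h.int_f.const_mul K).integrableOn
    (Eventually.of_forall fun x => by positivity), integral_const_mul]
  refine ENNReal.ofReal_le_ofReal
    ((mul_le_mul_of_nonneg_left (h.setIntegral_sq_le hx₀ hx₀m) hK0).trans (le_of_eq ?_))
  have h3 : m ^ (-r / 2 - 1) * (m ^ (r / 2 - 1) * m ^ 2) = 1 := by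
    rw [← Real.rpow_natCast, ← Real.rpow_add hm, ← Real.rpow_add hm]
    convert Real.rpow_zero m using 2
    push_cast
    ring
  rw [hK, Real.div_rpow (by norm_num) hm.le]
  have : m ^ (r / 2 - 1) ≠ 0 := (Real.rpow_pos_of_pos hm _).ne'
  generalize m ^ (r / 2 - 1) = a at this h3 ⊢
  generalize m ^ (-r / 2 - 1) = b at h3 ⊢
  field_simp
  linear_combination -h3

lemma lintegral_Ioc_rpow_le (h : IsHermiteSolution m f g) {x₀ r : ℝ} (hr : 0 ≤ r)
    (hx₀ : 0 ≤ x₀) (hx₀m : x₀ ^ 2 + m ^ 2 = m ^ 6) :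
    ∫⁻ x in Set.Ioc 0 x₀, ENNReal.ofReal (|f x| ^ r) ≤
      ENNReal.ofReal (12 ^ (r / 2) * m ^ (-(3 / 4) * r) *
        ∫ y in (m ^ 3 - x₀)..m ^ 3, y ^ (-r / 4)) := by
  have hm : 0 < m := one_pos.trans_le h.one_le
  have hxm : x₀ < m ^ 3 := by
    refine lt_of_pow_lt_pow_left₀ 2 (by positivity) ?_
    nlinarith [pow_pos hm 2]
  set K : ℝ := 12 ^ (r / 2) * m ^ (-(3 / 4) * r) with hK
  have hpt : ∀ x ∈ Set.Ioc 0 x₀, |f x| ^ r ≤ K * (m ^ 3 - x) ^ (-r / 4) := by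
    intro x hx
    have hd : 0 < m ^ 3 - x := by linarith [hx.2]
    have h1 := h.sq_le_of_inner hx.1.le (by nlinarith [hx.1, hx.2])
    have h2 : m ^ 3 * (m ^ 3 - x) ≤ m ^ 6 - x ^ 2 := by
      nlinarith [mul_pos hx.1 hd]
    have h3 : 0 < m ^ 3 * (m ^ 3 - x) := by positivity
    have h4 : f x ^ 2 ≤ 12 / √(m ^ 3 * (m ^ 3 - x)) :=
      h1.trans (div_le_div_of_nonneg_left (by norm_num) (Real.sqrt_pos.2 h3)
        (Real.sqrt_le_sqrt h2))
    refine (rpow_abs_le_of_sq_le hr h4).trans (le_of_eq ?_)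
    generalize m ^ 3 - x = d at hd h3 ⊢
    rw [Real.div_rpow (by norm_num) (Real.sqrt_nonneg _), Real.sqrt_eq_rpow,
      ← Real.rpow_mul h3.le, Real.mul_rpow (by positivity) hd.le, ← Real.rpow_natCast,
      ← Real.rpow_mul hm.le, hK,
      show (-(3 / 4) * r) = -(((3 : ℕ) : ℝ) * (1 / 2 * (r / 2))) by push_cast; ring,
      show -r / 4 = -(1 / 2 * (r / 2)) by ring, Real.rpow_neg hm.le, Real.rpow_neg hd.le]
    field_simp
  have hcont : IntervalIntegrable (fun x => (m ^ 3 - x) ^ (-r / 4)) volume 0 x₀ := by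
    refine ContinuousOn.intervalIntegrable fun x hx => ?_
    rw [Set.uIcc_of_le hx₀] at hx
    have hd : 0 < m ^ 3 - x := by linarith [hx.2]
    exact ((continuousAt_const.sub continuousAt_id).rpow_const
      (Or.inl hd.ne')).continuousWithinAt
  have hIoc : IntegrableOn (fun x => K * (m ^ 3 - x) ^ (-r / 4)) (Set.Ioc 0 x₀) :=
    ((intervalIntegrable_iff_integrableOn_Ioc_of_le hx₀).1 hcont).const_mul K
  refine (setLIntegral_mono' measurableSet_Ioc
    fun x hx => ENNReal.ofReal_le_ofReal (hpt x hx)).trans ?_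
  rw [← ofReal_integral_eq_lintegral_ofReal hIoc, integral_const_mul,
    ← intervalIntegral.integral_of_le hx₀,
    intervalIntegral.integral_comp_sub_left (fun y => y ^ (-r / 4)), sub_zero]
  refine (ae_restrict_iff' measurableSet_Ioc).2 (Eventually.of_forall fun x hx => ?_)
  exact (Real.rpow_nonneg (abs_nonneg _) r).trans (hpt x hx)

lemma lintegral_rpow_le (h : IsHermiteSolution m f g) (heven : ∀ x, |f (-x)| = |f x|) {r : ℝ}
    (hr : 2 ≤ r) {x₀ B : ℝ} (hx₀ : 0 ≤ x₀) (hx₀m : x₀ ^ 2 + m ^ 2 = m ^ 6) (hB0 : 0 ≤ B)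
    (hB : 12 ^ (r / 2) * m ^ (-(3 / 4) * r) * (∫ y in (m ^ 3 - x₀)..m ^ 3, y ^ (-r / 4)) ≤ B) :
    ∫⁻ x, ENNReal.ofReal (|f x| ^ r) ≤
      ENNReal.ofReal (2 * (B + 12 * 30 ^ (r / 2 - 1) * m ^ (-r / 2 - 1))) := by
  have hm : 0 < m := one_pos.trans_le h.one_le
  have hB2 : 0 ≤ 12 * 30 ^ (r / 2 - 1) * m ^ (-r / 2 - 1) := by positivity
  rw [lintegral_eq_two_mul_of_even (fun x => by rw [heven]),
    ENNReal.ofReal_mul (by norm_num), ENNReal.ofReal_add hB0 hB2, ENNReal.ofReal_ofNat,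
    ← Set.Ioc_union_Ioi_eq_Ioi hx₀]
  gcongr
  exact (lintegral_union_le _ _ _).trans (add_le_add
    ((h.lintegral_Ioc_rpow_le (by linarith) hx₀ hx₀m).trans (ENNReal.ofReal_le_ofReal hB))
    (h.lintegral_Ioi_rpow_le hr hx₀ hx₀m))

lemma exists_turning_point (hm : 1 ≤ m) :
    ∃ x₀, 0 ≤ x₀ ∧ x₀ ^ 2 + m ^ 2 = m ^ 6 ∧ 1 / (2 * m) ≤ m ^ 3 - x₀ := by
  have hm0 : 0 < m := one_pos.trans_le hm
  have hm6 : m ^ 2 ≤ m ^ 6 := pow_le_pow_right₀ hm (by norm_num)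
  have hx₀m : √(m ^ 6 - m ^ 2) ^ 2 + m ^ 2 = m ^ 6 := by
    rw [Real.sq_sqrt (by linarith)]; ring
  refine ⟨√(m ^ 6 - m ^ 2), Real.sqrt_nonneg _, hx₀m, ?_⟩
  have h1 : √(m ^ 6 - m ^ 2) ≤ m ^ 3 - 1 / (2 * m) := by
    refine Real.sqrt_le_iff.2 ⟨?_, ?_⟩
    · rw [sub_nonneg, div_le_iff₀ (by positivity)]
      have : 1 ≤ m ^ 4 := one_le_pow₀ hm
      nlinarith
    · have : (m ^ 3 - 1 / (2 * m)) ^ 2 = m ^ 6 - m ^ 2 + (1 / (2 * m)) ^ 2 := by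
        field_simp
        ring
      rw [this]
      linarith [sq_nonneg (1 / (2 * m))]
  linarith

end IsHermiteSolution

lemma exists_eLpNorm_le_of_lt_four {p : ℝ≥0∞} (h2 : 2 ≤ p) (h4 : p < 4) :
    ∃ C > (0 : ℝ), ∀ (m : ℝ) (f g : ℝ → ℝ), IsHermiteSolution m f g →
      (∀ x, |f (-x)| = |f x|) →
      eLpNorm f p volume ≤ ENNReal.ofReal (C * m ^ (3 / p.toReal - 3 / 2)) := by
  have hpt : p ≠ ∞ := h4.ne_top
  have hp0 : p ≠ 0 := (two_pos.trans_le h2).ne'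
  set r := p.toReal with hr
  have hr2 : 2 ≤ r := by simpa using ENNReal.toReal_mono hpt h2
  have hr4 : r < 4 := by simpa using (ENNReal.toReal_lt_toReal hpt (by simp)).2 h4
  have h14 : 0 < 1 - r / 4 := by linarith
  set D : ℝ := 2 * (12 ^ (r / 2) / (1 - r / 4) + 12 * 30 ^ (r / 2 - 1)) with hD
  have hD0 : 0 < D := by positivity
  refine ⟨D ^ (1 / r), by positivity, fun m f g h heven => ?_⟩
  have hm : 0 < m := one_pos.trans_le h.one_le
  obtain ⟨x₀, hx₀, hx₀m, hx₀'⟩ := IsHermiteSolution.exists_turning_point h.one_le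
  have hd : 0 < m ^ 3 - x₀ := lt_of_lt_of_le (by positivity) hx₀'
  have hJ : ∫ y in (m ^ 3 - x₀)..m ^ 3, y ^ (-r / 4) ≤ m ^ (3 - 3 / 4 * r) / (1 - r / 4) := by
    rw [integral_rpow (Or.inl (by linarith)), show -r / 4 + 1 = 1 - r / 4 by ring]
    refine div_le_div_of_nonneg_right ?_ h14.le
    have h1 : (m ^ 3) ^ (1 - r / 4) = m ^ (3 - 3 / 4 * r) := by
      rw [← Real.rpow_natCast, ← Real.rpow_mul hm.le]
      congr 1
      push_cast
      ring
    rw [h1]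
    linarith [Real.rpow_nonneg hd.le (1 - r / 4)]
  have hmain := h.lintegral_rpow_le heven hr2 (B := 12 ^ (r / 2) / (1 - r / 4) *
    m ^ (3 - 3 / 2 * r)) hx₀ hx₀m (by positivity) (by
      refine (mul_le_mul_of_nonneg_left hJ (by positivity)).trans (le_of_eq ?_)
      have : m ^ (3 - 3 / 2 * r) = m ^ (-(3 / 4) * r) * m ^ (3 - 3 / 4 * r) := by
        rw [← Real.rpow_add hm]
        congr 1
        ring
      rw [this]
      ring)
  have hle : 2 * (12 ^ (r / 2) / (1 - r / 4) * m ^ (3 - 3 / 2 * r) +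
      12 * 30 ^ (r / 2 - 1) * m ^ (-r / 2 - 1)) ≤ D * m ^ (3 - 3 / 2 * r) := by
    have h1 : m ^ (-r / 2 - 1) ≤ m ^ (3 - 3 / 2 * r) :=
      Real.rpow_le_rpow_of_exponent_le h.one_le (by linarith)
    have h3 : (0 : ℝ) ≤ 12 * 30 ^ (r / 2 - 1) := by positivity
    have := mul_le_mul_of_nonneg_left h1 h3
    rw [hD]
    linarith
  refine (eLpNorm_le_of_lintegral_le hp0 hpt (by positivity)
    (hmain.trans (ENNReal.ofReal_le_ofReal hle))).trans (le_of_eq ?_)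
  rw [← hr, Real.mul_rpow hD0.le (by positivity), ← Real.rpow_mul hm.le]
  congr 3
  field_simp

lemma exists_eLpNorm_le_of_four_lt {p : ℝ≥0∞} (h4 : 4 < p) :
    ∃ C > (0 : ℝ), ∀ (m : ℝ) (f g : ℝ → ℝ), IsHermiteSolution m f g →
      (∀ x, |f (-x)| = |f x|) →
      eLpNorm f p volume ≤ ENNReal.ofReal (C * m ^ (-(1 / 2) - 1 / p.toReal)) := by
  rcases eq_or_ne p ∞ with rfl | hpt
  · refine ⟨√30, by positivity, fun m f g h heven => ?_⟩
    have hm : 0 < m := one_pos.trans_le h.one_le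
    rw [eLpNorm_exponent_top]
    refine eLpNormEssSup_le_of_ae_bound (Eventually.of_forall fun x => ?_)
    have h1 : f |x| ^ 2 = f x ^ 2 := by
      rcases abs_choice x with hx | hx <;> rw [hx]
      rw [← sq_abs, heven, sq_abs]
    have h2 := h.sq_le (abs_nonneg x)
    rw [h1] at h2
    have h3 := Real.abs_le_sqrt h2
    rw [Real.sqrt_div (by norm_num)] at h3
    rw [Real.norm_eq_abs]
    refine h3.trans (le_of_eq ?_)
    simp only [ENNReal.toReal_top, div_zero, sub_zero]
    rw [Real.rpow_neg hm.le, ← Real.sqrt_eq_rpow, div_eq_mul_inv]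
  have hp0 : p ≠ 0 := (pos_of_gt h4).ne'
  set r := p.toReal with hr
  have hr4 : 4 < r := by simpa using (ENNReal.toReal_lt_toReal (by simp) hpt).2 h4
  have h14 : 0 < r / 4 - 1 := by linarith
  set D : ℝ := 2 * (12 ^ (r / 2) * 2 ^ (r / 4 - 1) / (r / 4 - 1) + 12 * 30 ^ (r / 2 - 1)) with hD
  have hD0 : 0 < D := by positivity
  refine ⟨D ^ (1 / r), by positivity, fun m f g h heven => ?_⟩
  have hm : 0 < m := one_pos.trans_le h.one_le
  obtain ⟨x₀, hx₀, hx₀m, hx₀'⟩ := IsHermiteSolution.exists_turning_point h.one_le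
  have hd : 0 < m ^ 3 - x₀ := lt_of_lt_of_le (by positivity) hx₀'
  have hJ : ∫ y in (m ^ 3 - x₀)..m ^ 3, y ^ (-r / 4) ≤
      2 ^ (r / 4 - 1) * m ^ (r / 4 - 1) / (r / 4 - 1) := by
    rw [integral_rpow (Or.inr ⟨by linarith, Set.notMem_uIcc_of_lt hd (by positivity)⟩),
      show -r / 4 + 1 = -(r / 4 - 1) by ring, div_neg, ← neg_div, neg_sub]
    refine div_le_div_of_nonneg_right ?_ h14.le
    have h1 : (m ^ 3 - x₀) ^ (-(r / 4 - 1)) ≤ (1 / (2 * m)) ^ (-(r / 4 - 1)) :=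
      Real.rpow_le_rpow_of_nonpos (by positivity) hx₀' (by linarith)
    have h2 : (1 / (2 * m)) ^ (-(r / 4 - 1)) = 2 ^ (r / 4 - 1) * m ^ (r / 4 - 1) := by
      rw [one_div, Real.inv_rpow (by positivity), Real.rpow_neg (by positivity), inv_inv,
        Real.mul_rpow (by norm_num) hm.le]
    have h3 : 0 ≤ (m ^ 3) ^ (-(r / 4 - 1)) := by positivity
    linarith
  have hmain := h.lintegral_rpow_le heven (r := r) (by linarith)
    (B := 12 ^ (r / 2) * 2 ^ (r / 4 - 1) / (r / 4 - 1) * m ^ (-r / 2 - 1)) hx₀ hx₀m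
    (by positivity) (by
      refine (mul_le_mul_of_nonneg_left hJ (by positivity)).trans (le_of_eq ?_)
      have : m ^ (-r / 2 - 1) = m ^ (-(3 / 4) * r) * m ^ (r / 4 - 1) := by
        rw [← Real.rpow_add hm]
        congr 1
        ring
      rw [this]
      ring)
  have hle : 2 * (12 ^ (r / 2) * 2 ^ (r / 4 - 1) / (r / 4 - 1) * m ^ (-r / 2 - 1) +
      12 * 30 ^ (r / 2 - 1) * m ^ (-r / 2 - 1)) = D * m ^ (-r / 2 - 1) := by
    rw [hD]
    ring
  rw [hle] at hmain
  refine (eLpNorm_le_of_lintegral_le hp0 hpt (by positivity) hmain).trans (le_of_eq ?_)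
  rw [← hr, Real.mul_rpow hD0.le (by positivity), ← Real.rpow_mul hm.le]
  congr 3
  have : r ≠ 0 := by linarith
  field_simp

lemma exists_isHermiteSolution_hermiteFun (k : ℕ) :
    ∃ g, IsHermiteSolution ((2 * k + 1 : ℝ) ^ (1 / 6 : ℝ)) (hermiteFun k) g := by
  have hk : (1 : ℝ) ≤ 2 * k + 1 := by linarith [k.cast_nonneg (α := ℝ)]
  refine isHermiteSolution_hermiteFun k (Real.one_le_rpow hk (by norm_num)) ?_
  rw [← Real.rpow_natCast, ← Real.rpow_mul (by linarith)]
  norm_num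

theorem stmt2 (p q : ℝ≥0∞) (hpq : 1 / p + 1 / q = 1) :
    ((2 ≤ p ∧ p < 4) → ∃ C > (0 : ℝ), ∀ ν : ℕ,
      eLpNorm (hermiteFun ν) p volume * eLpNorm (hermiteFun ν) q volume ≤
        ENNReal.ofReal C) ∧
    (4 < p → ∃ C > (0 : ℝ), ∀ ν : ℕ, 1 ≤ ν →
      eLpNorm (hermiteFun ν) p volume * eLpNorm (hermiteFun ν) q volume ≤
        ENNReal.ofReal (C * (ν : ℝ) ^ (-(1 : ℝ) / 6 + (2 / 3) * (1 / 2 - 1 / p.toReal)))) := by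
  have hpi := Real.pi_pos
  rw [one_div, one_div] at hpq
  have hq1 : 1 ≤ q := by
    rw [← ENNReal.inv_le_one, ← hpq]
    exact le_add_self
  have hp1 : 1 ≤ p := by
    rw [← ENNReal.inv_le_one, ← hpq]
    exact le_self_add
  have hreal : 1 / q.toReal = 1 - 1 / p.toReal := by
    have hp' : p⁻¹ ≠ ∞ := ENNReal.inv_ne_top.2 (one_pos.trans_le hp1).ne'
    have hq' : q⁻¹ ≠ ∞ := ENNReal.inv_ne_top.2 (one_pos.trans_le hq1).ne'
    have := congrArg ENNReal.toReal hpq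
    rw [ENNReal.toReal_add hp' hq', ENNReal.toReal_inv, ENNReal.toReal_inv,
      ENNReal.toReal_one] at this
    rw [one_div, one_div]
    linarith
  have hq2 : 2 ≤ p → q ≤ 2 := by
    intro h2
    have h3 : p⁻¹ ≤ 2⁻¹ := ENNReal.inv_le_inv.2 h2
    rw [← ENNReal.inv_le_inv]
    by_contra hlt
    have h4 : p⁻¹ + q⁻¹ < 2⁻¹ + 2⁻¹ := ENNReal.add_lt_add_of_le_of_lt
      (ne_top_of_le_ne_top (by simp) h3) h3 (not_le.1 hlt)
    rw [hpq, ENNReal.inv_two_add_inv_two] at h4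
    exact lt_irrefl _ h4
  have hexp : 3 / q.toReal - 3 / 2 = 3 / 2 - 3 / p.toReal := by
    linear_combination 3 * hreal
  set E : ℝ := (Real.pi + 2) ^ (1 / q.toReal) with hE
  have hE0 : 0 < E := by positivity
  constructor
  · rintro ⟨h2, h4⟩
    obtain ⟨C, hC, hbound⟩ := exists_eLpNorm_le_of_lt_four h2 h4
    refine ⟨C * E, by positivity, fun ν => ?_⟩
    obtain ⟨g, hg⟩ := exists_isHermiteSolution_hermiteFun ν
    set m : ℝ := (2 * ν + 1 : ℝ) ^ (1 / 6 : ℝ)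
    have hm : 0 < m := one_pos.trans_le hg.one_le
    refine (mul_le_mul' (hbound _ _ _ hg (abs_hermiteFun_neg ν))
      (hg.eLpNorm_le_of_le_two hq1 (hq2 h2))).trans (le_of_eq ?_)
    rw [← ENNReal.ofReal_mul (by positivity), hexp]
    congr 1
    have : m ^ (3 / p.toReal - 3 / 2) * m ^ (3 / 2 - 3 / p.toReal) = 1 := by
      rw [← Real.rpow_add hm]
      convert Real.rpow_zero m using 2
      ring
    linear_combination C * E * this
  · intro h4
    obtain ⟨C, hC, hbound⟩ := exists_eLpNorm_le_of_four_lt h4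
    set e : ℝ := -(1 : ℝ) / 6 + (2 / 3) * (1 / 2 - 1 / p.toReal) with he
    have he0 : 0 ≤ e := by
      rcases eq_or_ne p ∞ with rfl | hpt
      · rw [he]; norm_num
      · have hr4 : 4 < p.toReal := by
          simpa using (ENNReal.toReal_lt_toReal (by simp) hpt).2 h4
        have : 1 / p.toReal ≤ 1 / 4 := one_div_le_one_div_of_le (by norm_num) hr4.le
        rw [he]
        linarith
    refine ⟨C * E * 3 ^ e, by positivity, fun ν hν => ?_⟩
    have h2 : (2 : ℝ≥0∞) ≤ p := le_trans (by norm_num) h4.le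
    obtain ⟨g, hg⟩ := exists_isHermiteSolution_hermiteFun ν
    set m : ℝ := (2 * ν + 1 : ℝ) ^ (1 / 6 : ℝ) with hmdef
    have hm : 0 < m := one_pos.trans_le hg.one_le
    refine (mul_le_mul' (hbound _ _ _ hg (abs_hermiteFun_neg ν))
      (hg.eLpNorm_le_of_le_two hq1 (hq2 h2))).trans ?_
    rw [← ENNReal.ofReal_mul (by positivity), hexp]
    refine ENNReal.ofReal_le_ofReal ?_
    have hν1 : (1 : ℝ) ≤ ν := by exact_mod_cast hν
    have h5 : m ^ (-(1 / 2) - 1 / p.toReal) * m ^ (3 / 2 - 3 / p.toReal) = (2 * ν + 1 : ℝ) ^ e := by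
      rw [← Real.rpow_add hm, hmdef, ← Real.rpow_mul (by positivity)]
      congr 1
      rw [he]
      ring
    have h6 : (2 * ν + 1 : ℝ) ^ e ≤ 3 ^ e * (ν : ℝ) ^ e := by
      rw [← Real.mul_rpow (by norm_num) (by linarith)]
      exact Real.rpow_le_rpow (by positivity) (by linarith) he0
    have h7 := mul_le_mul_of_nonneg_left h6 (by positivity : 0 ≤ C * E)
    calc _ = C * E * (m ^ (-(1 / 2) - 1 / p.toReal) * m ^ (3 / 2 - 3 / p.toReal)) := by ring
      _ ≤ C * E * (3 ^ e * (ν : ℝ) ^ e) := by rw [h5]; exact h7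
      _ = _ := by ring
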